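/- Let w be an A₂ weight on ℝ^d. Then for every dyadic cube I ∈ 𝒟 and every α ∈ Γ_d, ∑_{J⊆I} ∑_{β: E_{β,J} ⊆ E_{α,I}} |ŵ^{-1/2}(J,β)|² ⟨w^{1/2}⟩²_{E_{β,J}} ≤ C_d · [w]²_{A₂} · |E_{α,I}|, where the sum is over dyadic cubes J ⊆ I and indices β ∈ Γ_d with E_{β,J} ⊆ E_{α,I}, ŵ^{-1/2}(J,β) = ⟨w^{-1/2}, h_J^β⟩_{L²}, and C_d depends only on the dimension d. -/

import Mathlib

open MeasureTheory

noncomputable section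

/-- A dyadic cube in `ℝ^d`: the cube `∏ᵢ [mᵢ 2^k, (mᵢ+1) 2^k)`. -/
structure DyadicCube (d : ℕ) where
  k : ℤ
  m : Fin d → ℤ
deriving DecidableEq

namespace DyadicCube

/-- The underlying set of a dyadic cube. -/
def toSet {d : ℕ} (I : DyadicCube d) : Set (Fin d → ℝ) :=
  {x | ∀ i, (I.m i : ℝ) * (2 : ℝ) ^ I.k ≤ x i ∧ x i < ((I.m i : ℝ) + 1) * (2 : ℝ) ^ I.k}

/-- `J` is a dyadic child of `I`. -/
def IsChild {d : ℕ} (J I : DyadicCube d) : Prop :=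
  J.k + 1 = I.k ∧ J.toSet ⊆ I.toSet

end DyadicCube

/-- The index set `Γ_d = {0,1}^d \ {(1,…,1)}`. -/
def Gamma (d : ℕ) : Type := {v : Fin d → Bool // v ≠ fun _ => true}

instance {d : ℕ} : DecidableEq (Gamma d) := Subtype.instDecidableEq

/-- The average `⟨f⟩_E` of `f` over a set `E`. -/
def avg {d : ℕ} (E : Set (Fin d → ℝ)) (f : (Fin d → ℝ) → ℝ) : ℝ :=
  (∫ x in E, f x) / (volume E).toReal

/-- An axis-parallel cube with corner `c` and side length `r`. -/
def Cube {d : ℕ} (c : Fin d → ℝ) (r : ℝ) : Set (Fin d → ℝ) :=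
  {x | ∀ i, c i ≤ x i ∧ x i < c i + r}

/-- `A` is an upper bound for the `A₂` characteristic of `w`:
`⟨w⟩_I ⟨w⁻¹⟩_I ≤ A` for every cube `I`. -/
def IsA2Bound {d : ℕ} (w : (Fin d → ℝ) → ℝ) (A : ℝ) : Prop :=
  ∀ (c : Fin d → ℝ) (r : ℝ), 0 < r →
    avg (Cube c r) w * avg (Cube c r) (fun x => (w x)⁻¹) ≤ A

/-- A weight: a positive, measurable, locally integrable function (with locally
integrable reciprocal). -/
def IsWeight {d : ℕ} (w : (Fin d → ℝ) → ℝ) : Prop :=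
  (∀ x, 0 < w x) ∧ Measurable w ∧ LocallyIntegrable w volume ∧
    LocallyIntegrable (fun x => (w x)⁻¹) volume

/-- The `L¹`-normalized indicator `h¹_E = 1_E / |E|`. -/
def h1 {d : ℕ} (E : Set (Fin d → ℝ)) : (Fin d → ℝ) → ℝ :=
  fun x => ((volume E).toReal)⁻¹ * E.indicator (fun _ => (1 : ℝ)) x

/-- Wilson's system of pairs of sets `(E¹_{α,I}, E²_{α,I})` indexed by dyadic cubes
`I` and `α ∈ Γ_d`. -/
structure WilsonSystem (d : ℕ) where
  E1 : DyadicCube d → Gamma d → Set (Fin d → ℝ)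
  E2 : DyadicCube d → Gamma d → Set (Fin d → ℝ)
  childUnion1 : ∀ I α, ∃ S : Finset (DyadicCube d), S.Nonempty ∧
    (∀ J ∈ S, J.IsChild I) ∧ E1 I α = ⋃ J ∈ S, J.toSet
  childUnion2 : ∀ I α, ∃ S : Finset (DyadicCube d), S.Nonempty ∧
    (∀ J ∈ S, J.IsChild I) ∧ E2 I α = ⋃ J ∈ S, J.toSet
  measEq : ∀ I α, volume (E1 I α) = volume (E2 I α)
  disj : ∀ I α, Disjoint (E1 I α) (E2 I α)
  nestedOrDisjoint : ∀ I α J β, (I, α) ≠ (J, β) →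
    (E1 I α ∪ E2 I α) ⊆ E1 J β ∨ (E1 I α ∪ E2 I α) ⊆ E2 J β ∨
    (E1 J β ∪ E2 J β) ⊆ E1 I α ∨ (E1 J β ∪ E2 J β) ⊆ E2 I α ∨
    Disjoint (E1 I α ∪ E2 I α) (E1 J β ∪ E2 J β)

namespace WilsonSystem

variable {d : ℕ}

/-- `E_{α,I} = E¹_{α,I} ∪ E²_{α,I}`. -/
def E (W : WilsonSystem d) (I : DyadicCube d) (α : Gamma d) : Set (Fin d → ℝ) :=
  W.E1 I α ∪ W.E2 I α

/-- The Wilson Haar function `h_I^α = |E_{α,I}|^{-1/2} (1_{E²_{α,I}} - 1_{E¹_{α,I}})`. -/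
def haar (W : WilsonSystem d) (I : DyadicCube d) (α : Gamma d) : (Fin d → ℝ) → ℝ :=
  fun x => (Real.sqrt (volume (W.E I α)).toReal)⁻¹ *
    ((W.E2 I α).indicator (fun _ => (1 : ℝ)) x - (W.E1 I α).indicator (fun _ => (1 : ℝ)) x)

/-- The Haar coefficient `f̂(I,α) = ⟨f, h_I^α⟩_{L²}`. -/
def hcoef (W : WilsonSystem d) (f : (Fin d → ℝ) → ℝ) (I : DyadicCube d) (α : Gamma d) : ℝ :=
  ∫ x, f x * W.haar I α x

/-- The weighted Wilson Haar function `h_I^{w,α}`. -/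
def haarW (W : WilsonSystem d) (w : (Fin d → ℝ) → ℝ) (I : DyadicCube d) (α : Gamma d) :
    (Fin d → ℝ) → ℝ :=
  fun x => (Real.sqrt (∫ y in W.E I α, w y))⁻¹ *
    (Real.sqrt ((∫ y in W.E1 I α, w y) / (∫ y in W.E2 I α, w y)) *
        (W.E2 I α).indicator (fun _ => (1 : ℝ)) x -
      Real.sqrt ((∫ y in W.E2 I α, w y) / (∫ y in W.E1 I α, w y)) *
        (W.E1 I α).indicator (fun _ => (1 : ℝ)) x)

/-- The Haar multiplier `T_σ f = ∑_{I,α} σ_{I,α} f̂(I,α) h_I^α`. -/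
def Tmult (W : WilsonSystem d) (σ : DyadicCube d → Gamma d → ℝ) (f : (Fin d → ℝ) → ℝ) :
    (Fin d → ℝ) → ℝ :=
  fun x => ∑' p : DyadicCube d × Gamma d, σ p.1 p.2 * W.hcoef f p.1 p.2 * W.haar p.1 p.2 x

/-- The paraproduct `P_a^{(0,0)} f = ∑_{I,α} a_{I,α} f̂(I,α) h_I^α`. -/
def P00 (W : WilsonSystem d) (a : DyadicCube d → Gamma d → ℝ) (f : (Fin d → ℝ) → ℝ) :
    (Fin d → ℝ) → ℝ :=
  fun x => ∑' p : DyadicCube d × Gamma d, a p.1 p.2 * W.hcoef f p.1 p.2 * W.haar p.1 p.2 x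

/-- The paraproduct `P_a^{(0,1)} f = ∑_{I,α} a_{I,α} ⟨f⟩_{E_{α,I}} h_I^α`. -/
def P01 (W : WilsonSystem d) (a : DyadicCube d → Gamma d → ℝ) (f : (Fin d → ℝ) → ℝ) :
    (Fin d → ℝ) → ℝ :=
  fun x => ∑' p : DyadicCube d × Gamma d, a p.1 p.2 * avg (W.E p.1 p.2) f * W.haar p.1 p.2 x

/-- The paraproduct `P_a^{(1,0)} f = ∑_{I,α} a_{I,α} f̂(I,α) h¹_{E_{α,I}}`. -/
def P10 (W : WilsonSystem d) (a : DyadicCube d → Gamma d → ℝ) (f : (Fin d → ℝ) → ℝ) :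
    (Fin d → ℝ) → ℝ :=
  fun x => ∑' p : DyadicCube d × Gamma d, a p.1 p.2 * W.hcoef f p.1 p.2 * h1 (W.E p.1 p.2) x

/-- The dyadic square function
`S f(x) = (∑_{I,α} |f̂(I,α)|² 1_I(x)/|I|)^{1/2}`. -/
def sqFn (W : WilsonSystem d) (f : (Fin d → ℝ) → ℝ) : (Fin d → ℝ) → ℝ :=
  fun x => Real.sqrt (∑' p : DyadicCube d × Gamma d,
    (W.hcoef f p.1 p.2) ^ 2 * p.1.toSet.indicator (fun _ => (1 : ℝ)) x /
      (volume p.1.toSet).toReal)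

/-- The canonical paraproduct of type `ε` built from the function `g`:
`ε = 0` gives `P^{(0,1)}_{ĝ}`, `ε = 1` gives `P^{(1,0)}_{ĝ}`, and `ε = 2` gives
`P^{(0,0)}_{⟨g⟩}`. -/
def paraOf (W : WilsonSystem d) (g : (Fin d → ℝ) → ℝ) (ε : Fin 3) :
    ((Fin d → ℝ) → ℝ) → ((Fin d → ℝ) → ℝ) :=
  if ε = 0 then W.P01 (fun I α => W.hcoef g I α)
  else if ε = 1 then W.P10 (fun I α => W.hcoef g I α)
  else W.P00 (fun I α => avg (W.E I α) g)

end WilsonSystem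

/-- The weighted measure `w(x) dx` on `ℝ^d`. -/
def wMeasure {d : ℕ} (w : (Fin d → ℝ) → ℝ) : Measure (Fin d → ℝ) :=
  volume.withDensity fun x => ENNReal.ofReal (w x)

/-- The functional `|S| log ⟨f⟩_S`. -/
def Lfun {d : ℕ} (f : (Fin d → ℝ) → ℝ) (S : Set (Fin d → ℝ)) : ℝ :=
  (volume S).toReal * Real.log (avg S f)

theorem aux_log_superadd {m₁ m₂ U₁ U₂ : ℝ} (h1 : 0 < m₁) (h2 : 0 < m₂) (hU1 : 0 < U₁)
    (hU2 : 0 < U₂) :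
    m₁ * Real.log (U₁ / m₁) + m₂ * Real.log (U₂ / m₂) ≤
      (m₁ + m₂) * Real.log ((U₁ + U₂) / (m₁ + m₂)) := by
  have hm : 0 < m₁ + m₂ := by linarith
  have hU : 0 < U₁ + U₂ := by linarith
  have key : ∀ m U : ℝ, 0 < m → 0 < U →
      m * Real.log (U / m) ≤ m * Real.log ((U₁ + U₂) / (m₁ + m₂)) +
        (U * ((m₁ + m₂) / (U₁ + U₂)) - m) := by
    intro m U hm' hU'
    have h := Real.log_le_sub_one_of_pos
      (show 0 < (U / m) / ((U₁ + U₂) / (m₁ + m₂)) by positivity)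
    rw [Real.log_div (by positivity) (by positivity)] at h
    have h' := mul_le_mul_of_nonneg_left h hm'.le
    have e : m * ((U / m) / ((U₁ + U₂) / (m₁ + m₂)) - 1) =
        U * ((m₁ + m₂) / (U₁ + U₂)) - m := by
      field_simp
    rw [e] at h'
    linarith
  have k1 := key m₁ U₁ h1 hU1
  have k2 := key m₂ U₂ h2 hU2
  have e : U₁ * ((m₁ + m₂) / (U₁ + U₂)) + U₂ * ((m₁ + m₂) / (U₁ + U₂)) = m₁ + m₂ := by
    field_simp
  linarith

theorem aux_log_half {m U₁ U₂ : ℝ} (h1 : 0 < m) (hU1 : 0 < U₁) (hU2 : 0 < U₂) :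
    m * Real.log (U₁ / m) + m * Real.log (U₂ / m) +
        (m + m) * ((U₂ - U₁) / (U₁ + U₂)) ^ 2 / 2 ≤
      (m + m) * Real.log ((U₁ + U₂) / (m + m)) := by
  have hx : 0 < (U₁ / m) * (U₂ / m) / ((U₁ + U₂) / (m + m)) ^ 2 := by positivity
  have h := Real.log_le_sub_one_of_pos hx
  rw [Real.log_div (by positivity) (by positivity), Real.log_mul (by positivity) (by positivity),
    Real.log_pow] at h
  have e : (U₁ / m) * (U₂ / m) / ((U₁ + U₂) / (m + m)) ^ 2 - 1 =
      -((U₂ - U₁) / (U₁ + U₂)) ^ 2 := by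
    field_simp
    ring
  rw [e] at h
  push_cast at h
  nlinarith [mul_le_mul_of_nonneg_left h h1.le]

section meas
variable {d : ℕ}

theorem aux_int_pos {f : (Fin d → ℝ) → ℝ} {S : Set (Fin d → ℝ)} (hf : ∀ x, 0 < f x)
    (hi : IntegrableOn f S) (h0 : 0 < (volume S).toReal) : 0 < ∫ x in S, f x := by
  rw [setIntegral_pos_iff_support_of_nonneg_ae (Filter.Eventually.of_forall fun x => (hf x).le) hi]
  have : Function.support f = Set.univ := by
    ext x; simp [(hf x).ne']
  rw [this, Set.univ_inter]
  exact (ENNReal.toReal_pos_iff.1 h0).1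

theorem aux_meas_add {S T : Set (Fin d → ℝ)} (hT : MeasurableSet T) (hd : Disjoint S T)
    (hS' : volume S ≠ ⊤) (hT' : volume T ≠ ⊤) :
    (volume (S ∪ T)).toReal = (volume S).toReal + (volume T).toReal := by
  rw [measure_union hd hT, ENNReal.toReal_add hS' hT']

theorem aux_null {f : (Fin d → ℝ) → ℝ} {S : Set (Fin d → ℝ)} (hS : volume S ≠ ⊤)
    (h : (volume S).toReal = 0) : ∫ x in S, f x = 0 := by
  rw [ENNReal.toReal_eq_zero_iff] at h
  exact setIntegral_measure_zero f (h.resolve_right hS)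

theorem Lfun_superadd {f : (Fin d → ℝ) → ℝ} {S T : Set (Fin d → ℝ)} (hf : ∀ x, 0 < f x)
    (hT : MeasurableSet T) (hd : Disjoint S T)
    (hS' : volume S ≠ ⊤) (hT' : volume T ≠ ⊤) (iS : IntegrableOn f S) (iT : IntegrableOn f T) :
    Lfun f S + Lfun f T ≤ Lfun f (S ∪ T) := by
  unfold Lfun avg
  rw [aux_meas_add hT hd hS' hT', setIntegral_union hd hT iS iT]
  rcases (ENNReal.toReal_nonneg (a := volume S)).eq_or_lt' with h | h
  · simp [h, aux_null (f := f) hS' h]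
  rcases (ENNReal.toReal_nonneg (a := volume T)).eq_or_lt' with h' | h'
  · simp [h', aux_null (f := f) hT' h']
  exact aux_log_superadd h h' (aux_int_pos hf iS h) (aux_int_pos hf iT h')

theorem Lfun_half {f : (Fin d → ℝ) → ℝ} {S T : Set (Fin d → ℝ)} (hf : ∀ x, 0 < f x)
    (hT : MeasurableSet T) (hd : Disjoint S T)
    (hS' : volume S ≠ ⊤) (hST : volume S = volume T) (hpos : 0 < (volume S).toReal)
    (iS : IntegrableOn f S) (iT : IntegrableOn f T) :
    Lfun f S + Lfun f T + (volume (S ∪ T)).toReal *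
      (((∫ x in T, f x) - ∫ x in S, f x) / ∫ x in S ∪ T, f x) ^ 2 / 2 ≤ Lfun f (S ∪ T) := by
  have hT' : volume T ≠ ⊤ := hST ▸ hS'
  unfold Lfun avg
  rw [aux_meas_add hT hd hS' hT', setIntegral_union hd hT iS iT, ← hST]
  exact aux_log_half hpos (aux_int_pos hf iS hpos) (aux_int_pos hf iT (hST ▸ hpos))

/-- Cauchy–Schwarz lower bound. -/
theorem aux_cs_low {u v : (Fin d → ℝ) → ℝ} {S : Set (Fin d → ℝ)} (hu : ∀ x, 0 < u x)
    (hv : ∀ x, 0 < v x) (huv : ∀ x, u x * v x = 1) (iu : IntegrableOn u S) (iv : IntegrableOn v S)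
    (hS : volume S ≠ ⊤) (hpos : 0 < (volume S).toReal) :
    1 ≤ avg S u * avg S v := by
  have hV := aux_int_pos hv iv hpos
  set V := ∫ x in S, v x with hVdef
  set m := (volume S).toReal with hm
  have h : ∫ x in S, (2 * V * m) ≤ ∫ x in S, (V ^ 2 * u x + m ^ 2 * v x) := by
    have : IsFiniteMeasure (volume.restrict S) := ⟨by simpa using hS.lt_top⟩
    refine integral_mono (integrable_const _) ((iu.const_mul _).add (iv.const_mul _)) ?_
    intro x
    have e := huv x
    have h2 := sq_nonneg (V * u x - m)
    have hux := hu x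
    have hvx := hv x
    have e2 : V ^ 2 * u x + m ^ 2 * v x - 2 * V * m = v x * (V * u x - m) ^ 2 := by
      linear_combination (-V^2 * u x + 2 * V * m) * e
    have := mul_nonneg hvx.le h2
    show 2 * V * m ≤ V ^ 2 * u x + m ^ 2 * v x
    linarith
  rw [integral_add (iu.const_mul _) (iv.const_mul _), setIntegral_const, smul_eq_mul,
    integral_const_mul, integral_const_mul, ← hVdef] at h
  have hr : volume.real S = m := rfl
  rw [hr] at h
  unfold avg
  rw [← hVdef, ← hm, div_mul_div_comm, le_div_iff₀ (by positivity)]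
  nlinarith

/-- Jensen / Cauchy–Schwarz upper bound. -/
theorem aux_cs_up {u u2 : (Fin d → ℝ) → ℝ} {S : Set (Fin d → ℝ)}
    (huv : ∀ x, u x ^ 2 = u2 x) (iu : IntegrableOn u S) (iv : IntegrableOn u2 S)
    (hS : volume S ≠ ⊤) (hpos : 0 < (volume S).toReal) :
    (∫ x in S, u x) ^ 2 ≤ (volume S).toReal * ∫ x in S, u2 x := by
  set U := ∫ x in S, u x with hU
  set m := (volume S).toReal with hm
  have h : ∫ x in S, (2 * (U * m) * u x) ≤ ∫ x in S, (m ^ 2 * u2 x + U ^ 2) := by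
    have : IsFiniteMeasure (volume.restrict S) := ⟨by simpa using hS.lt_top⟩
    refine integral_mono (iu.const_mul _) ((iv.const_mul _).add (integrable_const _)) ?_
    intro x
    show 2 * (U * m) * u x ≤ m ^ 2 * u2 x + U ^ 2
    rw [← huv x]
    nlinarith [sq_nonneg (m * u x - U)]
  have : IsFiniteMeasure (volume.restrict S) := ⟨by simpa using hS.lt_top⟩
  rw [integral_add (iv.const_mul _) (integrable_const _), integral_const_mul, integral_const_mul,
    setIntegral_const, smul_eq_mul, ← hU] at h
  have hr : volume.real S = m := rfl
  rw [hr] at h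
  nlinarith

theorem toSet_eq_pi (I : DyadicCube d) : I.toSet = Set.pi Set.univ
    (fun i => Set.Ico ((I.m i : ℝ) * (2 : ℝ) ^ I.k) (((I.m i : ℝ) + 1) * (2 : ℝ) ^ I.k)) := by
  ext x; simp [DyadicCube.toSet]

theorem toSet_meas (I : DyadicCube d) : MeasurableSet I.toSet := by
  rw [toSet_eq_pi]
  exact MeasurableSet.univ_pi fun i => measurableSet_Ico

theorem toSet_vol (I : DyadicCube d) :
    volume I.toSet = ENNReal.ofReal ((2 : ℝ) ^ I.k) ^ d := by
  rw [toSet_eq_pi, Real.volume_pi_Ico]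
  have : ∀ i, ((I.m i : ℝ) + 1) * (2 : ℝ) ^ I.k - (I.m i : ℝ) * (2 : ℝ) ^ I.k = (2 : ℝ) ^ I.k :=
    fun i => by ring
  simp [this]

theorem toSet_vol_ne_top (I : DyadicCube d) : volume I.toSet ≠ ⊤ := by
  rw [toSet_vol]; exact ENNReal.pow_ne_top ENNReal.ofReal_ne_top

theorem toSet_vol_real (I : DyadicCube d) : (volume I.toSet).toReal = ((2 : ℝ) ^ I.k) ^ d := by
  rw [toSet_vol, ENNReal.toReal_pow, ENNReal.toReal_ofReal (by positivity)]

theorem toSet_integrable {f : (Fin d → ℝ) → ℝ} (hf : LocallyIntegrable f volume)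
    (I : DyadicCube d) : IntegrableOn f I.toSet := by
  refine (hf.integrableOn_isCompact (isCompact_Icc (a := fun i => (I.m i : ℝ) * (2 : ℝ) ^ I.k)
    (b := fun i => ((I.m i : ℝ) + 1) * (2 : ℝ) ^ I.k))).mono_set ?_
  intro x hx
  exact ⟨fun i => (hx i).1, fun i => (hx i).2.le⟩

theorem toSet_cube (I : DyadicCube d) :
    I.toSet = Cube (fun i => (I.m i : ℝ) * (2 : ℝ) ^ I.k) ((2 : ℝ) ^ I.k) := by
  ext x
  simp only [DyadicCube.toSet, Cube, Set.mem_setOf_eq, add_mul, one_mul]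

/-- Properties of a union of children. -/
theorem childUnion_props {I : DyadicCube d} {E : Set (Fin d → ℝ)}
    (h : ∃ S : Finset (DyadicCube d), S.Nonempty ∧
    (∀ J ∈ S, J.IsChild I) ∧ E = ⋃ J ∈ S, J.toSet) :
    MeasurableSet E ∧ E ⊆ I.toSet ∧
      (volume I.toSet).toReal ≤ 2 ^ d * (volume E).toReal := by
  obtain ⟨S, ⟨J, hJ⟩, hch, rfl⟩ := h
  have hsub : (⋃ J ∈ S, J.toSet) ⊆ I.toSet := Set.iUnion₂_subset fun J hJ => (hch J hJ).2
  refine ⟨Finset.measurableSet_biUnion _ fun J _ => toSet_meas J, hsub, ?_⟩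
  have h1 : (volume J.toSet).toReal ≤ (volume (⋃ J ∈ S, J.toSet)).toReal :=
    ENNReal.toReal_mono (measure_ne_top_of_subset hsub (toSet_vol_ne_top I))
      (measure_mono (Set.subset_biUnion_of_mem (u := fun J : DyadicCube d => J.toSet) hJ))
  have h2 : (volume I.toSet).toReal = 2 ^ d * (volume J.toSet).toReal := by
    rw [toSet_vol_real, toSet_vol_real, ← (hch J hJ).1, zpow_add_one₀ (by norm_num), mul_pow,
      mul_comm]
  rw [h2]
  gcongr

end meas

section wil
variable {d : ℕ} (W : WilsonSystem d)

theorem E1_meas (I α) : MeasurableSet (W.E1 I α) := (childUnion_props (W.childUnion1 I α)).1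
theorem E2_meas (I α) : MeasurableSet (W.E2 I α) := (childUnion_props (W.childUnion2 I α)).1
theorem E_meas (I α) : MeasurableSet (W.E I α) := (E1_meas W I α).union (E2_meas W I α)
theorem E_sub (I α) : W.E I α ⊆ I.toSet :=
  Set.union_subset (childUnion_props (W.childUnion1 I α)).2.1
    (childUnion_props (W.childUnion2 I α)).2.1
theorem E_fin (I α) : volume (W.E I α) ≠ ⊤ :=
  measure_ne_top_of_subset (E_sub W I α) (toSet_vol_ne_top I)
theorem E1_fin (I α) : volume (W.E1 I α) ≠ ⊤ :=
  measure_ne_top_of_subset Set.subset_union_left (E_fin W I α)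
theorem E2_fin (I α) : volume (W.E2 I α) ≠ ⊤ :=
  measure_ne_top_of_subset Set.subset_union_right (E_fin W I α)
theorem E1_pos (I α) : 0 < (volume (W.E1 I α)).toReal := by
  have h := (childUnion_props (W.childUnion1 I α)).2.2
  rw [toSet_vol_real] at h
  have : (0:ℝ) < ((2 : ℝ) ^ I.k) ^ d := by positivity
  by_contra hc
  have h2 : (2:ℝ) ^ d * (volume (W.E1 I α)).toReal ≤ 0 :=
    mul_nonpos_of_nonneg_of_nonpos (by positivity) (not_lt.1 hc)
  linarith
theorem E_vol (I α) : (volume (W.E I α)).toReal = 2 * (volume (W.E1 I α)).toReal := by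
  unfold WilsonSystem.E
  rw [aux_meas_add (E2_meas W I α) (W.disj I α) (E1_fin W I α) (E2_fin W I α), ← W.measEq]
  ring
theorem E_pos (I α) : 0 < (volume (W.E I α)).toReal := by
  rw [E_vol]; have := E1_pos W I α; linarith
theorem E_comp (I α) : (volume I.toSet).toReal ≤ 2 ^ d * (volume (W.E I α)).toReal := by
  have h := (childUnion_props (W.childUnion1 I α)).2.2
  refine h.trans ?_
  rw [E_vol]
  have := E1_pos W I α
  gcongr
  linarith

/-- The Buckley-type telescoping estimate. -/
theorem buckley {u v : (Fin d → ℝ) → ℝ} {K : Set (Fin d → ℝ)} (hu : ∀ x, 0 < u x)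
    (hv : ∀ x, 0 < v x) (huv : ∀ x, u x * v x = 1) (iu : IntegrableOn u K) (iv : IntegrableOn v K)
    (hK : volume K ≠ ⊤) (F : Finset (DyadicCube d × Gamma d)) :
    ∀ S : Set (Fin d → ℝ), MeasurableSet S → S ⊆ K → (∀ p ∈ F, W.E p.1 p.2 ⊆ S) →
      ∑ p ∈ F, (volume (W.E p.1 p.2)).toReal *
        (((∫ x in W.E2 p.1 p.2, u x) - ∫ x in W.E1 p.1 p.2, u x) /
          ∫ x in W.E p.1 p.2, u x) ^ 2 / 2 ≤ Lfun u S + Lfun v S := by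
  classical
  induction F using Finset.strongInduction with
  | H F ih =>
  intro S hS hSK hF
  set a : DyadicCube d × Gamma d → ℝ := fun p => (volume (W.E p.1 p.2)).toReal *
        (((∫ x in W.E2 p.1 p.2, u x) - ∫ x in W.E1 p.1 p.2, u x) /
          ∫ x in W.E p.1 p.2, u x) ^ 2 / 2 with ha
  have ha0 : ∀ p, 0 ≤ a p := fun p => by simp only [ha]; positivity
  change ∑ p ∈ F, a p ≤ _
  have fin : ∀ T ⊆ K, volume T ≠ ⊤ := fun T hT => measure_ne_top_of_subset hT hK
  have hsup : ∀ T R : Set (Fin d → ℝ), T ⊆ K → R ⊆ K → MeasurableSet R → Disjoint T R →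
      (Lfun u T + Lfun v T) + (Lfun u R + Lfun v R) ≤ Lfun u (T ∪ R) + Lfun v (T ∪ R) := by
    intro T R hT hR hRm hd
    have h1 := Lfun_superadd hu hRm hd (fin T hT) (fin R hR) (iu.mono_set hT) (iu.mono_set hR)
    have h2 := Lfun_superadd hv hRm hd (fin T hT) (fin R hR) (iv.mono_set hT) (iv.mono_set hR)
    linarith
  rcases F.eq_empty_or_nonempty with rfl | hne
  · simp only [Finset.sum_empty]
    rcases (ENNReal.toReal_nonneg (a := volume S)).eq_or_lt' with h | h
    · simp [Lfun, h]
    · have h1 := aux_cs_low hu hv huv (iu.mono_set hSK) (iv.mono_set hSK) (fin S hSK) h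
      have p1 : 0 < avg S u := div_pos (aux_int_pos hu (iu.mono_set hSK) h) h
      have p2 : 0 < avg S v := div_pos (aux_int_pos hv (iv.mono_set hSK) h) h
      unfold Lfun
      rw [← mul_add, ← Real.log_mul p1.ne' p2.ne']
      exact mul_nonneg h.le (Real.log_nonneg h1)
  obtain ⟨p, hp, hmax⟩ := F.exists_max_image (fun q => (volume (W.E q.1 q.2)).toReal) hne
  have hpS := hF p hp
  have hE1 : W.E1 p.1 p.2 ⊆ W.E p.1 p.2 := Set.subset_union_left
  have hE2 : W.E2 p.1 p.2 ⊆ W.E p.1 p.2 := Set.subset_union_right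
  have hpK := hpS.trans hSK
  have hlt : ∀ P : DyadicCube d × Gamma d → Prop, (F.erase p).filter P ⊂ F := fun P =>
    lt_of_le_of_lt (Finset.filter_subset _ _) (Finset.erase_ssubset hp)
  have b1 := ih _ (hlt fun q => W.E q.1 q.2 ⊆ W.E1 p.1 p.2) (W.E1 p.1 p.2) (E1_meas W _ _)
    (hE1.trans hpK) (fun q hq => (Finset.mem_filter.1 hq).2)
  have b2 := ih _ (hlt fun q => W.E q.1 q.2 ⊆ W.E2 p.1 p.2) (W.E2 p.1 p.2) (E2_meas W _ _)
    (hE2.trans hpK) (fun q hq => (Finset.mem_filter.1 hq).2)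
  have b3 := ih _ (hlt fun q => W.E q.1 q.2 ⊆ S \ W.E p.1 p.2) (S \ W.E p.1 p.2)
    (hS.diff (E_meas W _ _))
    (Set.diff_subset.trans hSK) (fun q hq => (Finset.mem_filter.1 hq).2)
  change ∑ q ∈ _, a q ≤ _ at b1 b2 b3
  have hle : ∑ q ∈ F.erase p, a q ≤
      ∑ q ∈ (F.erase p).filter (fun q => W.E q.1 q.2 ⊆ W.E1 p.1 p.2), a q +
      ∑ q ∈ (F.erase p).filter (fun q => W.E q.1 q.2 ⊆ W.E2 p.1 p.2), a q +
      ∑ q ∈ (F.erase p).filter (fun q => W.E q.1 q.2 ⊆ S \ W.E p.1 p.2), a q := by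
    rw [Finset.sum_filter, Finset.sum_filter, Finset.sum_filter, ← Finset.sum_add_distrib,
      ← Finset.sum_add_distrib]
    refine Finset.sum_le_sum fun q hq => ?_
    have hqF := Finset.mem_of_mem_erase hq
    have hqp := Finset.ne_of_mem_erase hq
    have g : ∀ P : Prop, 0 ≤ if P then a q else 0 := fun P => by
      split_ifs <;> simp [ha0]
    have g1 := g (W.E q.1 q.2 ⊆ W.E1 p.1 p.2)
    have g2 := g (W.E q.1 q.2 ⊆ W.E2 p.1 p.2)
    have g3 := g (W.E q.1 q.2 ⊆ S \ W.E p.1 p.2)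
    have hbig : ∀ T, volume T ≠ ⊤ → (volume T).toReal = (volume (W.E1 q.1 q.2)).toReal →
        ¬ (W.E p.1 p.2 ⊆ T) := by
      intro T hT hTe hsub
      have k1 := ENNReal.toReal_mono hT (measure_mono hsub)
      have k2 := hmax q hqF
      have k3 := E_vol W q.1 q.2
      have k4 := E1_pos W q.1 q.2
      linarith
    rcases W.nestedOrDisjoint q.1 q.2 p.1 p.2 hqp with h | h | h | h | h
    · rw [if_pos (show W.E q.1 q.2 ⊆ W.E1 p.1 p.2 from h)]; linarith
    · rw [if_pos (show W.E q.1 q.2 ⊆ W.E2 p.1 p.2 from h)]; linarith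
    · exact absurd h (hbig _ (E1_fin W _ _) rfl)
    · exact absurd h (hbig _ (E2_fin W _ _) (by rw [W.measEq]))
    · rw [if_pos (show W.E q.1 q.2 ⊆ S \ W.E p.1 p.2 from
        Set.subset_diff.2 ⟨hF q hqF, h⟩)]; linarith
  have hsum := Finset.add_sum_erase F a hp
  have c1 := Lfun_half hu (E2_meas W p.1 p.2) (W.disj p.1 p.2) (E1_fin W _ _) (W.measEq _ _)
    (E1_pos W _ _) (iu.mono_set (hE1.trans hpK)) (iu.mono_set (hE2.trans hpK))
  have c2 := Lfun_superadd hv (E2_meas W p.1 p.2) (W.disj p.1 p.2) (E1_fin W _ _) (E2_fin W _ _)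
    (iv.mono_set (hE1.trans hpK)) (iv.mono_set (hE2.trans hpK))
  have c3 := hsup (W.E p.1 p.2) (S \ W.E p.1 p.2) hpK (Set.diff_subset.trans hSK)
    (hS.diff (E_meas W _ _)) Set.disjoint_sdiff_right
  rw [Set.union_diff_cancel hpS] at c3
  have c1' : Lfun u (W.E1 p.1 p.2) + Lfun u (W.E2 p.1 p.2) + a p ≤ Lfun u (W.E p.1 p.2) := c1
  have c2' : Lfun v (W.E1 p.1 p.2) + Lfun v (W.E2 p.1 p.2) ≤ Lfun v (W.E p.1 p.2) := c2
  linarith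

theorem hcoef_eq {u : (Fin d → ℝ) → ℝ} (I α) (iu : IntegrableOn u (W.E I α)) :
    W.hcoef u I α = (Real.sqrt (volume (W.E I α)).toReal)⁻¹ *
      ((∫ x in W.E2 I α, u x) - ∫ x in W.E1 I α, u x) := by
  unfold WilsonSystem.hcoef WilsonSystem.haar
  have i1 : IntegrableOn u (W.E1 I α) := iu.mono_set Set.subset_union_left
  have i2 : IntegrableOn u (W.E2 I α) := iu.mono_set Set.subset_union_right
  rw [← integral_indicator (E1_meas W I α), ← integral_indicator (E2_meas W I α),
    ← integral_sub (i2.integrable_indicator (E2_meas W I α))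
      (i1.integrable_indicator (E1_meas W I α)), ← integral_const_mul]
  congr 1
  ext x
  by_cases h1 : x ∈ W.E1 I α <;> by_cases h2 : x ∈ W.E2 I α <;> simp [h1, h2] <;> ring

/-- The `A₂` bound for `⟨w^{-1/2}⟩⟨w^{1/2}⟩` on the sets `E`. -/
theorem a2_E {u v w : (Fin d → ℝ) → ℝ} {A : ℝ} (hw : IsWeight w) (hA : IsA2Bound w A)
    (hu2 : ∀ x, u x ^ 2 = (w x)⁻¹) (hv2 : ∀ x, v x ^ 2 = w x) (I α)
    (iu : IntegrableOn u (W.E I α)) (iv : IntegrableOn v (W.E I α)) :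
    (avg (W.E I α) u * avg (W.E I α) v) ^ 2 ≤ 4 ^ d * A := by
  obtain ⟨hpos, hmeas, hl, hli⟩ := hw
  have hwi : ∀ x, 0 < (w x)⁻¹ := fun x => inv_pos.2 (hpos x)
  have iw := toSet_integrable hl I
  have iwi := toSet_integrable hli I
  have hm := E_pos W I α
  have hM : 0 < (volume I.toSet).toReal := by rw [toSet_vol_real]; positivity
  have hc := E_comp W I α
  have k1 := aux_cs_up hu2 iu (iwi.mono_set (E_sub W I α)) (E_fin W I α) hm
  have k2 := aux_cs_up hv2 iv (iw.mono_set (E_sub W I α)) (E_fin W I α) hm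
  have l1 : ∫ x in W.E I α, (w x)⁻¹ ≤ ∫ x in I.toSet, (w x)⁻¹ :=
    setIntegral_mono_set iwi (Filter.Eventually.of_forall fun x => (hwi x).le)
      (E_sub W I α).eventuallyLE
  have l2 : ∫ x in W.E I α, w x ≤ ∫ x in I.toSet, w x :=
    setIntegral_mono_set iw (Filter.Eventually.of_forall fun x => (hpos x).le)
      (E_sub W I α).eventuallyLE
  have n1 := (aux_int_pos hwi iwi hM).le
  have n2 := (aux_int_pos hpos iw hM).le
  have hA' := hA (fun i => (I.m i : ℝ) * (2 : ℝ) ^ I.k) ((2 : ℝ) ^ I.k) (by positivity)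
  rw [← toSet_cube] at hA'
  unfold avg at hA' ⊢
  set m := (volume (W.E I α)).toReal
  set M := (volume I.toSet).toReal
  set U := ∫ x in W.E I α, u x
  set V := ∫ x in W.E I α, v x
  set P := ∫ x in I.toSet, w x
  set Q := ∫ x in I.toSet, (w x)⁻¹
  rw [div_mul_div_comm, div_le_iff₀ (by positivity)] at hA'
  have hA0 : 0 ≤ A := by
    by_contra hcc
    nlinarith [mul_pos hM hM, mul_nonneg n2 n1]
  have k3 : U ^ 2 ≤ m * Q := k1.trans (by gcongr)
  have k4 : V ^ 2 ≤ m * P := k2.trans (by gcongr)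
  have k5 : U ^ 2 * V ^ 2 ≤ (m * Q) * (m * P) := mul_le_mul k3 k4 (sq_nonneg _) (by positivity)
  have k6 : M * M ≤ (2 ^ d * m) * (2 ^ d * m) := by gcongr
  have k7 : A * (M * M) ≤ A * ((2 ^ d * m) * (2 ^ d * m)) := by gcongr
  have e4 : (4 : ℝ) ^ d = 2 ^ d * 2 ^ d := by rw [← mul_pow]; norm_num
  have e : (U / m * (V / m)) ^ 2 = U ^ 2 * V ^ 2 / (m ^ 2 * m ^ 2) := by field_simp
  rw [e, div_le_iff₀ (by positivity), e4]
  calc U ^ 2 * V ^ 2 ≤ (m * Q) * (m * P) := k5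
    _ = m ^ 2 * (P * Q) := by ring
    _ ≤ m ^ 2 * (A * ((2 ^ d * m) * (2 ^ d * m))) := by
      exact mul_le_mul_of_nonneg_left (hA'.trans k7) (by positivity)
    _ = _ := by ring

end wil


/-- Square-function type Carleson estimate:
`∑_{J⊆I} ∑_{β : E_{β,J} ⊆ E_{α,I}} |ŵ^{-1/2}(J,β)|² ⟨w^{1/2}⟩²_{E_{β,J}}
  ≤ C_d [w]²_{A₂} |E_{α,I}|`. -/
theorem carleson_estimate_whalfinv_avgwhalf_sq (d : ℕ) :
    ∃ C : ℝ, 0 < C ∧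
      ∀ (W : WilsonSystem d) (w : (Fin d → ℝ) → ℝ) (A : ℝ),
        IsWeight w → IsA2Bound w A →
        ∀ (I : DyadicCube d) (α : Gamma d) (F : Finset (DyadicCube d × Gamma d)),
          (∀ p ∈ F, p.1.toSet ⊆ I.toSet ∧ W.E p.1 p.2 ⊆ W.E I α) →
          ∑ p ∈ F,
              (W.hcoef (fun x => (Real.sqrt (w x))⁻¹) p.1 p.2) ^ 2 *
                (avg (W.E p.1 p.2) (fun x => Real.sqrt (w x))) ^ 2 ≤
            C * A ^ 2 * (volume (W.E I α)).toReal := by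
  refine ⟨2 * 16 ^ d, by positivity, ?_⟩
  intro W w A hw hA I α F hF
  have hw' := hw
  obtain ⟨hpos, hmeas, hl, hli⟩ := hw'
  set u : (Fin d → ℝ) → ℝ := fun x => (Real.sqrt (w x))⁻¹ with hu_def
  set v : (Fin d → ℝ) → ℝ := fun x => Real.sqrt (w x) with hv_def
  have hv : ∀ x, 0 < v x := fun x => Real.sqrt_pos.2 (hpos x)
  have hu : ∀ x, 0 < u x := fun x => inv_pos.2 (hv x)
  have huv : ∀ x, u x * v x = 1 := fun x => inv_mul_cancel₀ (hv x).ne'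
  have hv2 : ∀ x, v x ^ 2 = w x := fun x => Real.sq_sqrt (hpos x).le
  have hu2 : ∀ x, u x ^ 2 = (w x)⁻¹ := fun x => by
    rw [← hv2 x]; exact inv_pow (v x) 2
  have hvm : Measurable v := hmeas.sqrt
  have hum : Measurable u := hvm.inv
  have hint : ∀ f g : (Fin d → ℝ) → ℝ, Measurable f → (∀ x, 0 < f x) → (∀ x, f x ^ 2 = g x) →
      LocallyIntegrable g volume → IntegrableOn f I.toSet := by
    intro f g hf hf0 hfg hg
    have : IsFiniteMeasure (volume.restrict I.toSet) :=
      ⟨by simpa using (toSet_vol_ne_top I).lt_top⟩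
    refine Integrable.mono' ((toSet_integrable hg I).add (integrable_const (1 : ℝ)))
      hf.aestronglyMeasurable (Filter.Eventually.of_forall fun x => ?_)
    rw [Real.norm_of_nonneg (hf0 x).le]
    show f x ≤ g x + 1
    rw [← hfg x]
    nlinarith [sq_nonneg (f x - 1)]
  have iu := hint u _ hum hu hu2 hli
  have iv := hint v _ hvm hv hv2 hl
  have hB := buckley W hu hv huv iu iv (toSet_vol_ne_top I) F (W.E I α) (E_meas W I α)
    (E_sub W I α) (fun p hp => (hF p hp).2)
  have ha0 := a2_E W hw hA hu2 hv2 I α (iu.mono_set (E_sub W I α)) (iv.mono_set (E_sub W I α))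
  have hm := E_pos W I α
  have hlow := aux_cs_low hu hv huv (iu.mono_set (E_sub W I α)) (iv.mono_set (E_sub W I α))
    (E_fin W I α) hm
  have hG : Lfun u (W.E I α) + Lfun v (W.E I α) ≤ (volume (W.E I α)).toReal * (4 ^ d * A) := by
    have p1 : 0 < avg (W.E I α) u := div_pos (aux_int_pos hu (iu.mono_set (E_sub W I α)) hm) hm
    have p2 : 0 < avg (W.E I α) v := div_pos (aux_int_pos hv (iv.mono_set (E_sub W I α)) hm) hm
    unfold Lfun
    rw [← mul_add, ← Real.log_mul p1.ne' p2.ne']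
    have h1 := Real.log_le_sub_one_of_pos (mul_pos p1 p2)
    refine mul_le_mul_of_nonneg_left ?_ hm.le
    nlinarith
  have hKA : 0 ≤ 4 ^ d * A := (sq_nonneg _).trans ha0
  have hterm : ∀ p ∈ F, (W.hcoef u p.1 p.2) ^ 2 * (avg (W.E p.1 p.2) v) ^ 2 ≤
      (2 * (4 ^ d * A)) * ((volume (W.E p.1 p.2)).toReal *
        (((∫ x in W.E2 p.1 p.2, u x) - ∫ x in W.E1 p.1 p.2, u x) /
          ∫ x in W.E p.1 p.2, u x) ^ 2 / 2) := by
    intro p hp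
    have hsub : W.E p.1 p.2 ⊆ I.toSet := (E_sub W p.1 p.2).trans (hF p hp).1
    have hmp := E_pos W p.1 p.2
    have h1 := a2_E W hw hA hu2 hv2 p.1 p.2 (iu.mono_set hsub) (iv.mono_set hsub)
    have hU := aux_int_pos hu (iu.mono_set hsub) hmp
    rw [hcoef_eq W p.1 p.2 (iu.mono_set hsub), mul_pow, inv_pow, Real.sq_sqrt hmp.le]
    unfold avg at h1 ⊢
    set m := (volume (W.E p.1 p.2)).toReal
    set U := ∫ x in W.E p.1 p.2, u x
    set D := (∫ x in W.E2 p.1 p.2, u x) - ∫ x in W.E1 p.1 p.2, u x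
    set V := ∫ x in W.E p.1 p.2, v x
    have e : m⁻¹ * D ^ 2 * (V / m) ^ 2 = (m * (D / U) ^ 2) * (U / m * (V / m)) ^ 2 := by
      field_simp
    rw [e]
    calc (m * (D / U) ^ 2) * (U / m * (V / m)) ^ 2 ≤ (m * (D / U) ^ 2) * (4 ^ d * A) := by
          gcongr
      _ = _ := by ring
  refine (Finset.sum_le_sum hterm).trans ?_
  rw [← Finset.mul_sum]
  have h16 : (16 : ℝ) ^ d = 4 ^ d * 4 ^ d := by rw [← mul_pow]; norm_num
  calc _ ≤ (2 * (4 ^ d * A)) * ((volume (W.E I α)).toReal * (4 ^ d * A)) :=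
        mul_le_mul_of_nonneg_left (hB.trans hG) (by linarith)
    _ = _ := by rw [h16]; ring
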